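/- arXiv:1007.3808 — 2 statements merged into one kernel-verified Lean document; each statement's English description precedes it below -/
import Mathlib

section
/- Let H_s be a 1×n parity-check matrix over F_3 all of whose entries lie in {0,1}, serving as the parity-check matrix of the ternary code C_s = {c ∈ F_3^n : c·H_s^T = 0}. Let F be a 2×n nonnegative integer matrix with F ∈ K_3(H_s), and suppose that, regarding H_s as a 0/1 integer matrix, H_s·(F_1^T + 2·F_2^T) ≡ 0 (mod 3), where F_1 and F_2 are the first and second rows of F. Then F is realizable over C_s, i.e., F is an unscaled graph-cover pseudocodeword matrix of C_s corresponding to some graph cover of H_s. -/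
open Finset

/-- Entry `f_i^(α)` of a 2×n matrix `F` whose rows are indexed by the nonzero
elements `1, 2` of `F_3` (row `0` of `F` is the row for `α = 1`,
row `1` of `F` is the row for `α = 2`). Only used with `α ≠ 0`. -/
def entryR {n : ℕ} (F : Matrix (Fin 2) (Fin n) ℝ) (α : ZMod 3) (i : Fin n) : ℝ :=
  if α = 1 then F 0 i else F 1 i

/-- The support `I_j` of the `j`-th row of `H`. -/
def suppRow {m n : ℕ} (H : Matrix (Fin m) (Fin n) (ZMod 3)) (j : Fin m) : Finset (Fin n) :=
  Finset.univ.filter fun i => H j i ≠ 0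

/-- The ternary fundamental cone `K_3(H)`. -/
def ternaryCone {m n : ℕ} (H : Matrix (Fin m) (Fin n) (ZMod 3)) :
    Set (Matrix (Fin 2) (Fin n) ℝ) :=
  { F |
    (∀ j : Fin m, ∀ ℓ ∈ suppRow H j,
      2 * entryR F (H j ℓ) ℓ + entryR F (2 * H j ℓ) ℓ ≤
        2 * ∑ i ∈ (suppRow H j).erase ℓ, entryR F (2 * H j i) i
          + ∑ i ∈ (suppRow H j).erase ℓ, entryR F (H j i) i) ∧
    (∀ j : Fin m, ∀ ℓ ∈ suppRow H j,
      2 * entryR F (2 * H j ℓ) ℓ + entryR F (H j ℓ) ℓ ≤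
        2 * ∑ i ∈ (suppRow H j).erase ℓ, entryR F (H j i) i
          + ∑ i ∈ (suppRow H j).erase ℓ, entryR F (2 * H j i) i) ∧
    (∀ j : Fin m, ∀ k ∈ suppRow H j, ∀ ℓ ∈ suppRow H j, k ≠ ℓ →
      entryR F (H j k) k + entryR F (H j ℓ) ℓ ≤
        2 * ∑ i ∈ ((suppRow H j).erase k).erase ℓ, entryR F (H j i) i
          + ∑ i ∈ suppRow H j, entryR F (2 * H j i) i) ∧
    (∀ j : Fin m, ∀ k ∈ suppRow H j, ∀ ℓ ∈ suppRow H j, k ≠ ℓ →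
      entryR F (2 * H j k) k + entryR F (2 * H j ℓ) ℓ ≤
        2 * ∑ i ∈ ((suppRow H j).erase k).erase ℓ, entryR F (2 * H j i) i
          + ∑ i ∈ suppRow H j, entryR F (H j i) i) ∧
    (∀ α i, 0 ≤ F α i) }

/-- `H·(F_1^T + 2 F_2^T) ≡ 0 (mod 3)` componentwise, `H` regarded as an
integer matrix with entries in `{0,1,2}`. -/
def mod3Cond {m n : ℕ} (H : Matrix (Fin m) (Fin n) (ZMod 3))
    (F : Matrix (Fin 2) (Fin n) ℕ) : Prop :=
  ∀ j : Fin m, (∑ i, ((H j i).val : ℤ) * ((F 0 i : ℤ) + 2 * (F 1 i : ℤ))) % 3 = 0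

/-- `F` is realizable over the single parity-check code `C_j` determined by the
row `Hj`: its entries count occurrences of the symbols `1` and `2` in the
coordinates of a list of `M` codewords. -/
def Realizable3 {n : ℕ} (Hj : Fin n → ZMod 3) (F : Matrix (Fin 2) (Fin n) ℕ) : Prop :=
  ∃ (M : ℕ) (c : Fin M → Fin n → ZMod 3),
    (∀ μ, ∑ i, c μ i * Hj i = 0) ∧
    (∀ i, F 0 i = (Finset.univ.filter fun μ => c μ i = 1).card) ∧
    (∀ i, F 1 i = (Finset.univ.filter fun μ => c μ i = 2).card)

/-- Matrices realizable over a single parity-check code form an additive submonoid. -/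
def realizableSubmonoid {n : ℕ} (H : Fin n → ZMod 3) :
    AddSubmonoid (Matrix (Fin 2) (Fin n) ℕ) where
  carrier := {F | Realizable3 H F}
  zero_mem' := ⟨0, Fin.elim0, fun μ => μ.elim0, by simp, by simp⟩
  add_mem' := by
    rintro F G ⟨M, c, hc, h1, h2⟩ ⟨M', c', hc', h1', h2'⟩
    refine ⟨M + M', Fin.append c c', fun μ => ?_, fun i => ?_, fun i => ?_⟩
    · refine Fin.addCases (fun j => ?_) (fun j => ?_) μ
      · simpa using hc j
      · simpa using hc' j
    · simp only [Matrix.add_apply, Finset.card_filter, Fin.sum_univ_add, Fin.append_left,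
        Fin.append_right, h1, h1']
    · simp only [Matrix.add_apply, Finset.card_filter, Fin.sum_univ_add, Fin.append_left,
        Fin.append_right, h2, h2']

lemma mem_realizableSubmonoid {n : ℕ} {H : Fin n → ZMod 3} {F : Matrix (Fin 2) (Fin n) ℕ} :
    F ∈ realizableSubmonoid H ↔ Realizable3 H F := Iff.rfl

/-- A single codeword gives a realizable matrix. -/
lemma realizable_of_codeword {n : ℕ} {H : Fin n → ZMod 3} (w : Fin n → ZMod 3)
    (hw : ∑ i, w i * H i = 0) (a b : Fin n → ℕ)
    (ha : ∀ i, a i = if w i = 1 then 1 else 0) (hb : ∀ i, b i = if w i = 2 then 1 else 0) :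
    Matrix.of ![a, b] ∈ realizableSubmonoid H :=
  ⟨1, fun _ => w, fun _ => hw, fun i => by by_cases h : w i = 1 <;> simp [ha, h],
    fun i => by by_cases h : w i = 2 <;> simp [hb, h]⟩

/-- Negating all codewords exchanges the two rows. -/
lemma realizable_swap {n : ℕ} {H : Fin n → ZMod 3} {a b : Fin n → ℕ}
    (h : Matrix.of ![a, b] ∈ realizableSubmonoid H) :
    Matrix.of ![b, a] ∈ realizableSubmonoid H := by
  obtain ⟨M, c, hc, h1, h2⟩ := h
  have e1 : ∀ z : ZMod 3, -z = 1 ↔ z = 2 := by decide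
  have e2 : ∀ z : ZMod 3, -z = 2 ↔ z = 1 := by decide
  exact ⟨M, fun μ i => -c μ i, fun μ => by simp [hc μ],
    fun i => by simpa [e1] using h2 i, fun i => by simpa [e2] using h1 i⟩

lemma realizable_pair {n : ℕ} {H : Fin n → ZMod 3} {k l : Fin n} (hkl : k ≠ l)
    (hk : H k = 1) (hl : H l = 1) :
    Matrix.of ![Pi.single k 1, Pi.single l 1] ∈ realizableSubmonoid H := by
  have d1 : (2 : ZMod 3) ≠ 1 := by decide
  have d2 : (1 : ZMod 3) ≠ 2 := by decide
  have d3 : (1 : ZMod 3) + 2 = 0 := by decide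
  have d4 : (0 : ZMod 3) ≠ 2 := by decide
  refine realizable_of_codeword (fun i => if i = k then 1 else if i = l then 2 else 0) ?_ _ _
    (fun i => ?_) (fun i => ?_)
  · have : ∀ i, (if i = k then 1 else if i = l then 2 else 0) * H i
        = (if i = k then 1 else 0) + (if i = l then (2 : ZMod 3) else 0) := by
      intro i
      by_cases h : i = k
      · subst h; simp [hk, hkl]
      · by_cases h' : i = l
        · subst h'; simp [hl, h]
        · simp [h, h']
    simp [this, Finset.sum_add_distrib, d3]
  · by_cases h : i = k
    · simp [h]
    · by_cases h' : i = l <;> simp [h, h', d1, hkl.symm]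
  · by_cases h : i = k
    · simp [h, d2, hkl]
    · by_cases h' : i = l <;> simp [h, h', d4, hkl.symm]

lemma realizable_triple {n : ℕ} {H : Fin n → ZMod 3} {T : Finset (Fin n)} (hT : T.card = 3)
    (hH : ∀ i ∈ T, H i = 1) :
    Matrix.of ![fun i => if i ∈ T then 1 else 0, 0] ∈ realizableSubmonoid H := by
  have d2 : (1 : ZMod 3) ≠ 2 := by decide
  have d4 : (0 : ZMod 3) ≠ 2 := by decide
  have d5 : (3 : ZMod 3) = 0 := by decide
  refine realizable_of_codeword (fun i => if i ∈ T then 1 else 0) ?_ _ _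
    (fun i => ?_) (fun i => ?_)
  · simp only [ite_mul, one_mul, zero_mul, Finset.sum_ite_mem, Finset.univ_inter]
    rw [Finset.sum_congr rfl hH]
    simp [hT, d5]
  · by_cases h : i ∈ T <;> simp [h]
  · by_cases h : i ∈ T <;> simp [h, d2, d4]

/-- Ones at coordinates outside the support of the check are unconstrained. -/
lemma realizable_of_eq_zero_on_support {n : ℕ} {H : Fin n → ZMod 3} {a : Fin n → ℕ}
    (ha : ∀ i, H i ≠ 0 → a i = 0) : Matrix.of ![a, 0] ∈ realizableSubmonoid H := by
  have d4 : (0 : ZMod 3) ≠ 2 := by decide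
  have d2 : (1 : ZMod 3) ≠ 2 := by decide
  have key : Matrix.of ![a, 0] =
      ∑ i, a i • (Matrix.of ![Pi.single i 1, 0] : Matrix (Fin 2) (Fin n) ℕ) := by
    ext α j
    fin_cases α <;> simp [Matrix.sum_apply, Pi.single_apply]
  rw [key]
  refine sum_mem fun i _ => ?_
  by_cases hi : H i = 0
  · refine nsmul_mem (realizable_of_codeword (Pi.single i 1) ?_ _ _ (fun j => ?_)
      (fun j => ?_)) _
    · simp [Pi.single_apply, hi]
    · by_cases h : j = i <;> simp [h]
    · by_cases h : j = i <;> simp [h, d2, d4]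
  · simp [ha i hi]

/-- Ones alone split into words of three ones when no coordinate has more than a third of
them. -/
lemma realizable_triples {n : ℕ} {H : Fin n → ZMod 3} (hH : ∀ i, H i = 0 ∨ H i = 1) (t : ℕ) :
    ∀ y : Fin n → ℕ, (∀ i, H i = 0 → y i = 0) → ∑ i, y i = 3 * t → (∀ i, y i ≤ t) →
      Matrix.of ![y, 0] ∈ realizableSubmonoid H := by
  induction t with
  | zero =>
    intro y _ _ hle
    exact realizable_of_eq_zero_on_support fun i _ => Nat.le_zero.1 (hle i)
  | succ t ih =>
    intro y h0 hsum hle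
    have hsub : (univ.filter fun i => y i = t + 1) ⊆ univ.filter fun i => y i ≠ 0 := by
      intro i hi
      simp only [mem_filter, mem_univ, true_and] at hi ⊢
      omega
    have hlow : (univ.filter fun i => y i = t + 1).card ≤ 3 := by
      have h1 : ∑ i ∈ univ.filter (fun i => y i = t + 1), y i ≤ ∑ i, y i :=
        Finset.sum_le_sum_of_subset (Finset.filter_subset _ _)
      rw [Finset.sum_congr rfl (g := fun _ => t + 1) (by simp), Finset.sum_const, hsum,
        smul_eq_mul] at h1
      exact Nat.le_of_mul_le_mul_right h1 t.succ_pos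
    have hhigh : 3 ≤ (univ.filter fun i => y i ≠ 0).card := by
      have h1 : ∑ i, y i ≤ (univ.filter fun i => y i ≠ 0).card * (t + 1) := by
        rw [← Finset.sum_filter_ne_zero, ← smul_eq_mul]
        exact Finset.sum_le_card_nsmul _ _ _ fun i _ => hle i
      rw [hsum] at h1
      exact Nat.le_of_mul_le_mul_right h1 t.succ_pos
    obtain ⟨T, hT1, hT2, hT⟩ := Finset.exists_subsuperset_card_eq hsub hlow hhigh
    have hpos : ∀ i ∈ T, 1 ≤ y i := fun i hi => by
      have := hT2 hi
      simp only [mem_filter, mem_univ, true_and] at this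
      omega
    have htight : ∀ i, i ∉ T → y i ≤ t := fun i hi => by
      have h1 : y i ≠ t + 1 := fun h => hi (hT1 (by simp [h]))
      have := hle i
      omega
    have hy : y = (fun i => y i - if i ∈ T then 1 else 0) + fun i => if i ∈ T then 1 else 0 := by
      ext i
      by_cases hi : i ∈ T
      · have := hpos i hi
        simp [hi]; omega
      · simp [hi]
    have hsplit : (Matrix.of ![y, 0] : Matrix (Fin 2) (Fin n) ℕ) =
        Matrix.of ![fun i => y i - if i ∈ T then 1 else 0, 0]
          + Matrix.of ![fun i => if i ∈ T then 1 else 0, 0] := by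
      ext α i
      fin_cases α
      · exact congrFun hy i
      · rfl
    rw [hsplit]
    refine add_mem (ih _ (fun i hi => by simp [h0 i hi]) ?_ fun i => ?_)
      (realizable_triple hT fun i hi => ?_)
    · have h1 : ∑ i, y i = ∑ i, (y i - if i ∈ T then 1 else 0)
          + ∑ i, if i ∈ T then 1 else 0 := by
        rw [← Finset.sum_add_distrib]
        exact Finset.sum_congr rfl fun i _ => congrFun hy i
      have h2 : ∑ i, (if i ∈ T then 1 else 0) = 3 := by simp [hT]
      omega
    · by_cases hi : i ∈ T
      · have := hle i
        simp [hi]; omega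
      · simpa [hi] using htight i hi
    · refine (hH i).resolve_left fun h => ?_
      have := hpos i hi
      have := h0 i h
      omega

/-- Equally many ones and twos can be matched across distinct coordinates, provided that no
coordinate carries more than half of all symbols. -/
lemma realizable_pairs {n : ℕ} {H : Fin n → ZMod 3} (hH : ∀ i, H i = 0 ∨ H i = 1)
    {x b : Fin n → ℕ} (hx : ∀ i, H i = 0 → x i = 0) (hb : ∀ i, H i = 0 → b i = 0)
    (hsum : ∑ i, x i = ∑ i, b i) (hle : ∀ i, x i + b i ≤ ∑ j, b j) :
    Matrix.of ![x, b] ∈ realizableSubmonoid H := by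
  obtain ⟨φ, hφ, hne⟩ := (Finset.all_card_le_biUnion_card_iff_exists_injective
    (fun s : (Σ i, Fin (x i)) => univ.filter fun r : (Σ i, Fin (b i)) => r.1 ≠ s.1)).1 (by
    intro S
    by_cases hS : ∃ s ∈ S, ∃ s' ∈ S, s.1 ≠ s'.1
    · obtain ⟨s, hs, s', hs', hss⟩ := hS
      have : S.biUnion (fun s => univ.filter fun r : (Σ i, Fin (b i)) => r.1 ≠ s.1) = univ := by
        ext r
        simp only [mem_biUnion, mem_filter, mem_univ, true_and, iff_true]
        by_cases h : r.1 = s.1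
        · exact ⟨s', hs', h ▸ hss⟩
        · exact ⟨s, hs, h⟩
      rw [this]
      refine S.card_le_univ.trans ?_
      simp [hsum]
    · push Not at hS
      obtain rfl | ⟨s, hs⟩ := S.eq_empty_or_nonempty
      · simp
      refine le_trans ?_ (Finset.card_le_card (Finset.subset_biUnion_of_mem _ hs))
      have h1 : S.card ≤ x s.1 := by
        have : S ⊆ univ.map ⟨Sigma.mk s.1, sigma_mk_injective⟩ := by
          rintro ⟨i, r⟩ hr
          obtain rfl : s.1 = i := hS s hs _ hr
          simp
        simpa using Finset.card_le_card this
      have h2 : (univ.filter fun r : (Σ i, Fin (b i)) => r.1 = s.1).card ≤ b s.1 := by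
        have : (univ.filter fun r : (Σ i, Fin (b i)) => r.1 = s.1) ⊆
            univ.map ⟨Sigma.mk s.1, sigma_mk_injective⟩ := by
          rintro ⟨i, r⟩ hr
          obtain rfl : i = s.1 := by simpa using hr
          simp
        simpa using Finset.card_le_card this
      have h3 := Finset.card_filter_add_card_filter_not (s := univ)
        (fun r : (Σ i, Fin (b i)) => r.1 = s.1)
      have h4 : (univ : Finset (Σ i, Fin (b i))).card = ∑ i, b i := by simp
      have := hle s.1
      simp only [ne_eq] at h3 ⊢
      omega)
  have hbij : Function.Bijective φ :=
    (Fintype.bijective_iff_injective_and_card φ).2 ⟨hφ, by simp [hsum]⟩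
  have count : ∀ z : Fin n → ℕ, ∀ j, ∑ s : (Σ i, Fin (z i)), Pi.single (M := fun _ => ℕ) s.1 1 j
      = z j := by
    intro z j
    rw [Fintype.sum_sigma]
    simp [Pi.single_apply]
  have key : Matrix.of ![x, b] = ∑ s : (Σ i, Fin (x i)),
      (Matrix.of ![Pi.single s.1 1, Pi.single (φ s).1 1] : Matrix (Fin 2) (Fin n) ℕ) := by
    ext α j
    rw [Matrix.sum_apply]
    fin_cases α
    · exact (count x j).symm
    · exact (count b j).symm.trans
        (hbij.sum_comp fun r => Pi.single (M := fun _ => ℕ) r.1 1 j).symm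
  have one : ∀ z : Fin n → ℕ, (∀ i, H i = 0 → z i = 0) → ∀ s : (Σ i, Fin (z i)), H s.1 = 1 :=
    fun z hz s => (hH s.1).resolve_left fun h => by
      have := s.2.isLt
      have := hz _ h
      omega
  rw [key]
  refine sum_mem fun s _ => realizable_pair ?_ (one x hx s) (one b hb (φ s))
  simpa using (Finset.mem_filter.1 (hne s)).2.symm

/-- An integer vector with prescribed sum between two given bounds. -/
lemma exists_between_sum_eq {ι : Type*} [Fintype ι] {lo hi : ι → ℕ}
    (h : ∀ i, lo i ≤ hi i) {B : ℕ} (hlo : ∑ i, lo i ≤ B) (hhi : B ≤ ∑ i, hi i) :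
    ∃ x : ι → ℕ, (∀ i, lo i ≤ x i) ∧ (∀ i, x i ≤ hi i) ∧ ∑ i, x i = B := by
  classical
  induction B, hlo using Nat.le_induction with
  | base => exact ⟨lo, fun _ => le_rfl, h, rfl⟩
  | succ B _ ih =>
    obtain ⟨x, h1, h2, h3⟩ := ih (by omega)
    obtain ⟨i, -, hi⟩ := Finset.exists_lt_of_sum_lt (s := univ) (f := x) (g := hi) (by omega)
    refine ⟨x + Pi.single i 1, fun j => (h1 j).trans (by simp), fun j => ?_, ?_⟩
    · by_cases hj : j = i
      · subst hj; simpa using hi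
      · simpa [hj] using h2 j
    · simp [Finset.sum_add_distrib, h3]

/-- Excess over `t` of a vector with sum `B + 3 * t`. -/
lemma sum_tsub_le {ι : Type*} [Fintype ι] [DecidableEq ι] {a : ι → ℕ} {B t : ℕ}
    (hsum : ∑ i, a i = B + 3 * t) (h1 : ∀ l, a l ≤ B + t)
    (h2 : ∀ k l, k ≠ l → a k + a l ≤ B + 2 * t) : ∑ i, (a i - t) ≤ B := by
  set S := univ.filter fun i => t < a i with hS
  have hzero : ∀ i, i ∉ S → a i - t = 0 := fun i hi => by
    simp only [hS, mem_filter, mem_univ, true_and] at hi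
    omega
  have hS1 : ∑ i, (a i - t) = ∑ i ∈ S, (a i - t) :=
    (Finset.sum_subset (Finset.subset_univ _) fun i _ hi => hzero i hi).symm
  rw [hS1]
  rcases lt_or_ge S.card 3 with hc | hc
  · interval_cases hcard : S.card
    · simp [Finset.card_eq_zero.1 hcard]
    · obtain ⟨l, hl⟩ := Finset.card_eq_one.1 hcard
      have := h1 l
      rw [hl, Finset.sum_singleton]
      omega
    · obtain ⟨k, l, hkl, hl⟩ := Finset.card_eq_two.1 hcard
      have := h2 k l hkl
      have hk' : k ∈ S := by simp [hl]
      have hl' : l ∈ S := by simp [hl]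
      simp only [hS, mem_filter, mem_univ, true_and] at hk' hl'
      rw [hl, Finset.sum_pair hkl]
      omega
  · have e1 : ∑ i ∈ S, (a i - t) + S.card * t = ∑ i ∈ S, a i := by
      rw [← smul_eq_mul, ← Finset.sum_const, ← Finset.sum_add_distrib]
      refine Finset.sum_congr rfl fun i hi => ?_
      simp only [hS, mem_filter, mem_univ, true_and] at hi
      omega
    have e2 : ∑ i ∈ S, a i ≤ ∑ i, a i := Finset.sum_le_sum_of_subset (Finset.subset_univ _)
    have e3 : 3 * t ≤ S.card * t := Nat.mul_le_mul_right t hc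
    omega

lemma le_sum_min {ι : Type*} [Fintype ι] [DecidableEq ι] {a b : ι → ℕ}
    (hsum : ∑ i, b i ≤ ∑ i, a i) (h1 : ∀ l, a l + b l ≤ ∑ i, a i) :
    ∑ i, b i ≤ ∑ i, min (a i) (∑ j, b j - b i) := by
  set B := ∑ j, b j with hB
  by_cases h : ∃ l, B - b l < a l
  · obtain ⟨l, hl⟩ := h
    have hbl : b l ≤ B := Finset.single_le_sum (fun _ _ => Nat.zero_le _) (mem_univ l)
    have hbs := Finset.add_sum_erase univ b (mem_univ l)
    have e := Finset.add_sum_erase univ (fun i => min (a i) (B - b i)) (mem_univ l)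
    by_cases h' : ∃ k, k ≠ l ∧ B - b k < a k
    · obtain ⟨k, hkl, hk⟩ := h'
      have e1 : b k ≤ ∑ i ∈ univ.erase l, b i :=
        Finset.single_le_sum (fun _ _ => Nat.zero_le _) (by simp [hkl])
      have e2 : min (a k) (B - b k) ≤ ∑ i ∈ univ.erase l, min (a i) (B - b i) :=
        Finset.single_le_sum (f := fun i => min (a i) (B - b i)) (fun _ _ => Nat.zero_le _)
          (by simp [hkl])
      omega
    · push Not at h'
      have e1 : ∑ i ∈ univ.erase l, min (a i) (B - b i) = ∑ i ∈ univ.erase l, a i :=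
        Finset.sum_congr rfl fun i hi => min_eq_left (h' i (Finset.ne_of_mem_erase hi))
      have e2 := Finset.add_sum_erase univ a (mem_univ l)
      have := h1 l
      omega
  · push Not at h
    rwa [Finset.sum_congr rfl fun i _ => min_eq_left (h i)]

/-- Realizability when ones are at least as frequent as twos. -/
lemma realizable_of_sum_eq {n : ℕ} {H : Fin n → ZMod 3} (hH : ∀ i, H i = 0 ∨ H i = 1)
    {a b : Fin n → ℕ} (ha : ∀ i, H i = 0 → a i = 0) (hb : ∀ i, H i = 0 → b i = 0) {t : ℕ}
    (hsum : ∑ i, a i = ∑ i, b i + 3 * t) (h1 : ∀ l, a l + b l ≤ ∑ i, b i + t)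
    (h2 : ∀ k l, k ≠ l → a k + a l ≤ ∑ i, b i + 2 * t) :
    Matrix.of ![a, b] ∈ realizableSubmonoid H := by
  have hbl : ∀ l, b l ≤ ∑ i, b i := fun l =>
    Finset.single_le_sum (fun _ _ => Nat.zero_le _) (mem_univ l)
  obtain ⟨x, hlo, hhi, hx⟩ := exists_between_sum_eq (lo := fun i => a i - t)
    (hi := fun i => min (a i) (∑ j, b j - b i)) (B := ∑ i, b i)
    (fun i => by have := h1 i; have := hbl i; omega)
    (sum_tsub_le hsum (fun l => by have := h1 l; omega) h2)
    (le_sum_min (by omega) fun l => by have := h1 l; omega)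
  simp only [le_min_iff] at hhi
  have hsplit : (Matrix.of ![a, b] : Matrix (Fin 2) (Fin n) ℕ) =
      Matrix.of ![x, b] + Matrix.of ![fun i => a i - x i, 0] := by
    ext α i
    fin_cases α
    · have := hhi i
      simp; omega
    · simp
  have hsub : ∑ i, a i = ∑ i, x i + ∑ i, (a i - x i) := by
    rw [← Finset.sum_add_distrib]
    exact Finset.sum_congr rfl fun i _ => by have := hhi i; omega
  rw [hsplit]
  refine add_mem (realizable_pairs hH (fun i hi => ?_) hb hx fun i => ?_)
    (realizable_triples hH t _ (fun i hi => ?_) ?_ fun i => ?_)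
  · have := ha i hi; have := hhi i; omega
  · have := hhi i; have := hbl i; omega
  · have := ha i hi; omega
  · omega
  · have := hlo i; omega

/-- Lemma 7: if `H_s` is a 1×n parity-check matrix over `F_3` with entries in
`{0,1}`, `F` is a nonnegative integer matrix with `F ∈ K_3(H_s)` and
`H_s·(F_1^T + 2 F_2^T) ≡ 0 (mod 3)`, then `F` is realizable over the code
`C_s` checked by `H_s`, i.e., `F` is an unscaled graph-cover pseudocodeword
matrix of `C_s`. -/
theorem two_types_realizable {n : ℕ} (Hs : Fin n → ZMod 3)
    (hHs : ∀ i, Hs i = 0 ∨ Hs i = 1)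
    (F : Matrix (Fin 2) (Fin n) ℕ)
    (hcone : F.map (fun x => (x : ℝ)) ∈ ternaryCone (Matrix.of fun (_ : Fin 1) i => Hs i))
    (hmod : (∑ i, ((Hs i).val : ℤ) * ((F 0 i : ℤ) + 2 * (F 1 i : ℤ))) % 3 = 0) :
    Realizable3 Hs F := by
  set I : Finset (Fin n) := univ.filter fun i => Hs i ≠ 0 with hI
  have hone : ∀ i ∈ I, Hs i = 1 := fun i hi =>
    (hHs i).resolve_left (by simpa [hI] using hi)
  set a : Fin n → ℕ := fun i => if Hs i = 0 then 0 else F 0 i with ha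
  set b : Fin n → ℕ := fun i => if Hs i = 0 then 0 else F 1 i with hb
  have hzero : ∀ i, Hs i = 0 → a i = 0 ∧ b i = 0 := fun i hi => by simp [ha, hb, hi]
  have hnot : ∀ i, i ∉ I → Hs i = 0 := fun i hi => by simpa [hI] using hi
  have hsumI : ∀ z : Fin n → ℕ, (∀ i, Hs i = 0 → z i = 0) →
      (∑ i ∈ I, (z i : ℝ)) = ((∑ i, z i : ℕ) : ℝ) := fun z hz => by
    rw [Nat.cast_sum]
    exact Finset.sum_subset (Finset.subset_univ _) fun i _ hi => by simp [hz i (hnot i hi)]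
  have hA := hsumI a fun i hi => (hzero i hi).1
  have hB := hsumI b fun i hi => (hzero i hi).2
  set A := ∑ i, a i
  set B := ∑ i, b i
  have d : (2 : ZMod 3) ≠ 1 := by decide
  have r1 : ∀ i ∈ I, entryR (F.map (fun x => (x : ℝ))) (Hs i) i = a i := fun i hi => by
    simp [entryR, hone i hi, ha]
  have r2 : ∀ i ∈ I, entryR (F.map (fun x => (x : ℝ))) (2 * Hs i) i = b i := fun i hi => by
    simp [entryR, hone i hi, hb, d]
  obtain ⟨c1, c2, c3, c4, -⟩ := hcone
  have hsupp : suppRow (Matrix.of fun (_ : Fin 1) i => Hs i) 0 = I := rfl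
  have e1 : ∀ l ∈ I, ∑ i ∈ I.erase l, entryR (F.map (fun x => (x : ℝ))) (Hs i) i
      = A - a l := fun l hl => by
    rw [Finset.sum_congr rfl fun i hi => r1 i (Finset.mem_of_mem_erase hi), ← hA,
      Finset.sum_erase_eq_sub hl]
  have e2 : ∀ l ∈ I, ∑ i ∈ I.erase l, entryR (F.map (fun x => (x : ℝ))) (2 * Hs i) i
      = B - b l := fun l hl => by
    rw [Finset.sum_congr rfl fun i hi => r2 i (Finset.mem_of_mem_erase hi), ← hB,
      Finset.sum_erase_eq_sub hl]
  have g1 : ∀ l, 3 * (a l + b l) ≤ A + 2 * B := fun l => by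
    by_cases hl : l ∈ I
    · have := c1 0 l (hsupp ▸ hl)
      simp only [hsupp, Matrix.of_apply] at this
      rw [r1 l hl, r2 l hl, e1 l hl, e2 l hl] at this
      have h : (3 * (a l + b l) : ℝ) ≤ A + 2 * B := by linarith
      exact_mod_cast h
    · have := hzero l (hnot l hl); omega
  have g2 : ∀ l, 3 * (a l + b l) ≤ 2 * A + B := fun l => by
    by_cases hl : l ∈ I
    · have := c2 0 l (hsupp ▸ hl)
      simp only [hsupp, Matrix.of_apply] at this
      rw [r1 l hl, r2 l hl, e1 l hl, e2 l hl] at this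
      have h : (3 * (a l + b l) : ℝ) ≤ 2 * A + B := by linarith
      exact_mod_cast h
    · have := hzero l (hnot l hl); omega
  have g3 : ∀ k l, k ≠ l → 3 * (a k + a l) ≤ 2 * A + B := fun k l hkl => by
    by_cases hk : k ∈ I
    · by_cases hl : l ∈ I
      · have := c3 0 k (hsupp ▸ hk) l (hsupp ▸ hl) hkl
        simp only [hsupp, Matrix.of_apply] at this
        rw [Finset.sum_erase_eq_sub (Finset.mem_erase.2 ⟨hkl.symm, hl⟩), e1 k hk,
          Finset.sum_congr rfl r2, hB, r1 k hk, r1 l hl] at this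
        have h : (3 * (a k + a l) : ℝ) ≤ 2 * A + B := by linarith
        exact_mod_cast h
      · have := hzero l (hnot l hl); have := g2 k; omega
    · have := hzero k (hnot k hk); have := g2 l; omega
  have g4 : ∀ k l, k ≠ l → 3 * (b k + b l) ≤ A + 2 * B := fun k l hkl => by
    by_cases hk : k ∈ I
    · by_cases hl : l ∈ I
      · have := c4 0 k (hsupp ▸ hk) l (hsupp ▸ hl) hkl
        simp only [hsupp, Matrix.of_apply] at this
        rw [Finset.sum_erase_eq_sub (Finset.mem_erase.2 ⟨hkl.symm, hl⟩), e2 k hk,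
          Finset.sum_congr rfl r1, hA, r2 k hk, r2 l hl] at this
        have h : (3 * (b k + b l) : ℝ) ≤ A + 2 * B := by linarith
        exact_mod_cast h
      · have := hzero l (hnot l hl); have := g1 k; omega
    · have := hzero k (hnot k hk); have := g1 l; omega
  have hmod' : (A + 2 * B) % 3 = 0 := by
    have : ∑ i, ((Hs i).val : ℤ) * ((F 0 i : ℤ) + 2 * (F 1 i : ℤ)) = ((A + 2 * B : ℕ) : ℤ) := by
      simp only [A, B, Nat.cast_add, Nat.cast_mul, Nat.cast_sum, Finset.mul_sum,
        ← Finset.sum_add_distrib]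
      refine Finset.sum_congr rfl fun i _ => ?_
      have v : (1 : ZMod 3).val = 1 := rfl
      rcases hHs i with h | h <;> simp [ha, hb, h, v]
    omega
  have hon : Matrix.of ![a, b] ∈ realizableSubmonoid Hs := by
    rcases le_total B A with h | h
    · obtain ⟨t, ht⟩ : ∃ t, A = B + 3 * t := ⟨(A - B) / 3, by omega⟩
      exact realizable_of_sum_eq hHs (fun i hi => (hzero i hi).1) (fun i hi => (hzero i hi).2) ht
        (fun l => by have := g1 l; omega) fun k l hkl => by have := g3 k l hkl; omega
    · obtain ⟨t, ht⟩ : ∃ t, B = A + 3 * t := ⟨(B - A) / 3, by omega⟩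
      exact realizable_swap <| realizable_of_sum_eq hHs (fun i hi => (hzero i hi).2)
        (fun i hi => (hzero i hi).1) ht (fun l => by have := g2 l; omega)
        fun k l hkl => by have := g4 k l hkl; omega
  have hoff : ∀ α, Matrix.of ![fun i => if Hs i = 0 then F α i else 0, 0]
      ∈ realizableSubmonoid Hs := fun α =>
    realizable_of_eq_zero_on_support fun i hi => by simp [hi]
  have hF : F = Matrix.of ![a, b] + (Matrix.of ![fun i => if Hs i = 0 then F 0 i else 0, 0]
      + Matrix.of ![0, fun i => if Hs i = 0 then F 1 i else 0]) := by
    ext α i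
    fin_cases α <;> by_cases hi : Hs i = 0 <;> simp [ha, hb, hi]
  rw [← mem_realizableSubmonoid, hF]
  exact add_mem hon (add_mem (hoff 0) (realizable_swap (hoff 1)))
end

section
/- Let H_1 be a 1×n parity-check matrix over F_3 with support I_1, and let F = (f_i^(α)) be a 2×n nonnegative integer matrix with F ∈ K_3(H_1) satisfying, with H_1 regarded as an integer matrix with entries in {0,1,2}, H_1·(F_1^T + 2·F_2^T) ≡ 0 (mod 3), where F_1, F_2 are the rows of F. Suppose ℓ ∈ I_1 is a critical coordinate of type two, i.e., f_ℓ^(1) + f_ℓ^(2) ≥ 1 and 2·Σ_{i∈I_1\{ℓ}} f_i^(H_{1,i}) + Σ_{i∈I_1\{ℓ}} f_i^(2H_{1,i}) < 2·f_ℓ^(2H_{1,ℓ}) + f_ℓ^(H_{1,ℓ}) + 3. Then the corresponding cone inequality holds with equality: 2·Σ_{i∈I_1\{ℓ}} f_i^(H_{1,i}) + Σ_{i∈I_1\{ℓ}} f_i^(2H_{1,i}) = 2·f_ℓ^(2H_{1,ℓ}) + f_ℓ^(H_{1,ℓ}). -/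
open Finset

/-- Integer-valued counterpart of `entryR`. -/
def entryZ {n : ℕ} (F : Matrix (Fin 2) (Fin n) ℕ) (α : ZMod 3) (i : Fin n) : ℤ :=
  if α = 1 then F 0 i else F 1 i

lemma entryR_map_natCast {n : ℕ} (F : Matrix (Fin 2) (Fin n) ℕ) (α : ZMod 3) (i : Fin n) :
    entryR (F.map (fun x => (x : ℝ))) α i = (entryZ F α i : ℝ) := by
  unfold entryR entryZ
  split_ifs <;> simp

lemma three_dvd_two_mul_entryZ_add_sub {n : ℕ} (F : Matrix (Fin 2) (Fin n) ℕ) (a : ZMod 3)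
    (ha : a ≠ 0) (i : Fin n) :
    (3 : ℤ) ∣ 2 * entryZ F a i + entryZ F (2 * a) i
      - 2 * ((a.val : ℤ) * ((F 0 i : ℤ) + 2 * (F 1 i : ℤ))) := by
  have h : a = 1 ∨ a = 2 := by
    revert a
    decide
  rcases h with rfl | rfl
  · have h2 : ¬ (2 * 1 : ZMod 3) = 1 := by decide
    have hv : ((1 : ZMod 3).val : ℤ) = 1 := rfl
    simp only [entryZ, if_neg h2, if_true, hv]
    omega
  · have h1 : ¬ (2 : ZMod 3) = 1 := by decide
    have h2 : (2 * 2 : ZMod 3) = 1 := by decide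
    have hv : ((2 : ZMod 3).val : ℤ) = 2 := rfl
    simp only [entryZ, if_neg h1, if_pos h2, hv]
    omega

/-- Under the congruence condition, the symbol-weighted sum over the support of a check
is divisible by three. -/
lemma mod3Cond.three_dvd_sum_entryZ {m n : ℕ} {H : Matrix (Fin m) (Fin n) (ZMod 3)}
    {F : Matrix (Fin 2) (Fin n) ℕ} (hmod : mod3Cond H F) (j : Fin m) :
    (3 : ℤ) ∣ ∑ i ∈ suppRow H j, (2 * entryZ F (H j i) i + entryZ F (2 * H j i) i) := by
  have hsum : ∑ i ∈ suppRow H j, ((H j i).val : ℤ) * ((F 0 i : ℤ) + 2 * (F 1 i : ℤ))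
      = ∑ i, ((H j i).val : ℤ) * ((F 0 i : ℤ) + 2 * (F 1 i : ℤ)) := by
    refine Finset.sum_subset (Finset.subset_univ _) fun i _ hi => ?_
    have h0 : H j i = 0 := by simpa [suppRow] using hi
    simp [h0]
  have hdiff := Finset.dvd_sum fun i (hi : i ∈ suppRow H j) =>
    three_dvd_two_mul_entryZ_add_sub F (H j i) (by simpa [suppRow] using hi) i
  rw [Finset.sum_sub_distrib, ← Finset.mul_sum, hsum] at hdiff
  exact (dvd_sub_left ((Int.dvd_of_emod_eq_zero (hmod j)).mul_left 2)).1 hdiff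

/-- Lemma 8, case of a critical coordinate of type two: for a nonnegative
integer matrix `F ∈ K_3(H_1)` satisfying `H_1·(F_1^T + 2 F_2^T) ≡ 0 (mod 3)`,
a critical inequality of type two at a coordinate `ℓ ∈ I_1` holds with
equality. -/
theorem critical_coordinate_type_two {n : ℕ} (H : Matrix (Fin 1) (Fin n) (ZMod 3))
    (F : Matrix (Fin 2) (Fin n) ℕ)
    (hcone : F.map (fun x => (x : ℝ)) ∈ ternaryCone H)
    (hmod : mod3Cond H F)
    (ℓ : Fin n) (hℓ : ℓ ∈ suppRow H 0)
    (hpos : 1 ≤ F 0 ℓ + F 1 ℓ)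
    (hcrit :
      2 * ∑ i ∈ (suppRow H 0).erase ℓ, entryR (F.map (fun x => (x : ℝ))) (H 0 i) i
        + ∑ i ∈ (suppRow H 0).erase ℓ, entryR (F.map (fun x => (x : ℝ))) (2 * H 0 i) i
      < 2 * entryR (F.map (fun x => (x : ℝ))) (2 * H 0 ℓ) ℓ
        + entryR (F.map (fun x => (x : ℝ))) (H 0 ℓ) ℓ + 3) :
    2 * ∑ i ∈ (suppRow H 0).erase ℓ, entryR (F.map (fun x => (x : ℝ))) (H 0 i) i
      + ∑ i ∈ (suppRow H 0).erase ℓ, entryR (F.map (fun x => (x : ℝ))) (2 * H 0 i) i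
    = 2 * entryR (F.map (fun x => (x : ℝ))) (2 * H 0 ℓ) ℓ
      + entryR (F.map (fun x => (x : ℝ))) (H 0 ℓ) ℓ := by
  have hlow := hcone.2.1 0 ℓ hℓ
  have hdvd := hmod.three_dvd_sum_entryZ 0
  rw [← Finset.add_sum_erase _ _ hℓ, Finset.sum_add_distrib, ← Finset.mul_sum] at hdvd
  simp only [entryR_map_natCast] at hlow hcrit ⊢
  norm_cast at hlow hcrit ⊢
  omega
end
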